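/- Let s ≥ 1 be an integer dividing n and suppose m = n/s. Then the number of connected components of W is at least n! / (n_1! · n_2! ⋯ n_k! · (s!)^{n/s}). -/

import Mathlib

/-- A configuration: `k` arrays (array `i` has `sizes i` real entries),
`m` query values, and `m` answer values. As a finite product of copies of `ℝ`,
it carries the (Euclidean) product topology. -/
abbrev Config (k m : ℕ) (sizes : Fin k → ℕ) : Type :=
  ((i : Fin k) → Fin (sizes i) → ℝ) × (Fin m → ℝ) × (Fin m → ℝ)

/-- The set `W` of valid configurations: every array is nondecreasing and, for each
query index `j`, the answer `p j` is the strict predecessor of the query `q j` among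
all array entries: `p j` is some array entry, `p j < q j`, and every array entry
smaller than `q j` is at most `p j`. -/
def W (k m : ℕ) (sizes : Fin k → ℕ) : Set (Config k m sizes) :=
  { x | (∀ i : Fin k, Monotone (x.1 i)) ∧
        ∀ j : Fin m,
          (∃ (r : Fin k) (l : Fin (sizes r)), x.1 r l = x.2.2 j) ∧
          x.2.2 j < x.2.1 j ∧
          ∀ (r : Fin k) (l : Fin (sizes r)), x.1 r l < x.2.1 j → x.1 r l ≤ x.2.2 j }

open Finset in
/-- Precomposing `f` with all permutations of its domain yields at least
`|α|! / ∏ b, |f ⁻¹ b|!` different functions. -/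
theorem factorial_card_le_card_image_comp_perm {α β : Type*} [Fintype α] [DecidableEq α]
    [Fintype β] [DecidableEq β] (f : α → β) :
    (Fintype.card α).factorial ≤ (∏ b, (Fintype.card {a // f a = b}).factorial) *
      #((univ : Finset (Equiv.Perm α)).image fun σ : Equiv.Perm α => f ∘ σ) := by
  rw [← Fintype.card_perm, ← card_univ]
  refine card_le_mul_card_image_of_maps_to (fun σ hσ => mem_image_of_mem _ hσ) _ fun g hg => ?_
  obtain ⟨τ, -, rfl⟩ := mem_image.mp hg
  rw [← DomMulAct.stabilizer_card f, ← Fintype.card_subtype]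
  refine Fintype.card_le_of_injective
    (fun σ => ⟨τ⁻¹.trans σ.1, ?_⟩) fun σ σ' h => ?_
  · have := σ.2
    funext a
    simpa using congrFun this (τ⁻¹ a)
  · apply Subtype.ext
    ext a
    simpa using DFunLike.congr_fun (congrArg Subtype.val h) (τ a)

open Finset in
/-- A family of functions on a sigma type that is closed under permuting each fibre has at most
`∏ i, (sizes i)!` times as many members as it has members that are monotone on each fibre. -/
theorem card_le_prod_factorial_mul_card_filter_monotone {ι β : Type*} [Fintype ι] [DecidableEq ι]
    [LinearOrder β] (sizes : ι → ℕ) (S : Finset ((Σ i, Fin (sizes i)) → β))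
    (hS : ∀ f ∈ S, ∀ σ : Equiv.Perm (Σ i, Fin (sizes i)), f ∘ σ ∈ S)
    [DecidablePred fun f : (Σ i, Fin (sizes i)) → β => ∀ i, Monotone fun l => f ⟨i, l⟩] :
    #S ≤ (∏ i, (sizes i).factorial) * #{f ∈ S | ∀ i, Monotone fun l => f ⟨i, l⟩} := by
  let sorting (f : (Σ i, Fin (sizes i)) → β) (i : ι) : Equiv.Perm (Fin (sizes i)) :=
    Tuple.sort fun l => f ⟨i, l⟩
  refine card_le_mul_card_image_of_maps_to
    (f := fun f => f ∘ Equiv.sigmaCongrRight (sorting f)) (fun f hf => ?_) _ fun g _ => ?_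
  · exact mem_filter.mpr ⟨hS f hf _, fun i => Tuple.monotone_sort fun l => f ⟨i, l⟩⟩
  · calc _ ≤ #((univ : Finset (∀ i, Equiv.Perm (Fin (sizes i)))).image
              fun τ => g ∘ (Equiv.sigmaCongrRight τ).symm) := card_le_card fun f hf => ?_
      _ ≤ _ := card_image_le
      _ = _ := by simp [Fintype.card_pi, Fintype.card_perm]
    refine mem_image.mpr ⟨sorting f, mem_univ _, ?_⟩
    rw [← (mem_filter.mp hf).2]
    funext a
    exact congrArg f (Equiv.apply_symm_apply _ a)

section

variable {k m : ℕ} {sizes : Fin k → ℕ}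

/-- On `W`, being smaller than a query is a clopen condition on an array entry. -/
theorem isClopen_setOf_entry_lt_query (i : Fin k) (l : Fin (sizes i)) (j : Fin m) :
    IsClopen {x : W k m sizes | x.1.1 i l < x.1.2.1 j} := by
  constructor
  · have : {x : W k m sizes | x.1.1 i l < x.1.2.1 j} = {x | x.1.1 i l ≤ x.1.2.2 j} := by
      ext x
      exact ⟨(x.2.2 j).2.2 i l, fun h => lt_of_le_of_lt h (x.2.2 j).2.1⟩
    rw [this]
    exact isClosed_le (by fun_prop) (by fun_prop)
  · exact isOpen_lt (by fun_prop) (by fun_prop)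

/-- The configuration with entries `g`, queries `j + 1 / 2` and answers `j`. -/
noncomputable def blockConfig (g : (Σ i, Fin (sizes i)) → Fin m) : Config k m sizes :=
  (fun i l => (g ⟨i, l⟩ : ℕ), fun j => (j : ℕ) + 1 / 2, fun j => (j : ℕ))

theorem blockConfig_entry_lt_query_iff (g : (Σ i, Fin (sizes i)) → Fin m) (i : Fin k)
    (l : Fin (sizes i)) (j : Fin m) :
    (blockConfig g).1 i l < (blockConfig g).2.1 j ↔ g ⟨i, l⟩ ≤ j := by
  simp only [blockConfig, Fin.le_def]
  constructor
  · intro h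
    have : ((g ⟨i, l⟩ : ℕ) : ℝ) < ((j + 1 : ℕ) : ℝ) := by push_cast; linarith
    exact Nat.lt_succ_iff.mp (Nat.cast_lt.mp this)
  · intro h
    have : ((g ⟨i, l⟩ : ℕ) : ℝ) ≤ ((j : ℕ) : ℝ) := Nat.cast_le.mpr h
    linarith

theorem blockConfig_mem_W {g : (Σ i, Fin (sizes i)) → Fin m}
    (hmono : ∀ i, Monotone fun l => g ⟨i, l⟩) (hsurj : Function.Surjective g) :
    blockConfig g ∈ W k m sizes := by
  refine ⟨fun i l l' h => Nat.cast_le.mpr (hmono i h), fun j => ⟨?_, ?_, fun r l h => ?_⟩⟩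
  · obtain ⟨⟨r, l⟩, h⟩ := hsurj j
    exact ⟨r, l, by simp [blockConfig, h]⟩
  · simp [blockConfig]
  · exact Nat.cast_le.mpr ((blockConfig_entry_lt_query_iff g r l j).mp h)

/-- Distinct block configurations lie in distinct components of `W`. -/
theorem eq_of_blockConfig_connected {g g' : (Σ i, Fin (sizes i)) → Fin m}
    (hg : blockConfig g ∈ W k m sizes) (hg' : blockConfig g' ∈ W k m sizes)
    (h : ((⟨_, hg⟩ : W k m sizes) : ConnectedComponents (W k m sizes)) =
      ((⟨_, hg'⟩ : W k m sizes) : ConnectedComponents (W k m sizes))) : g = g' := by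
  have key : ∀ a j, g a ≤ j ↔ g' a ≤ j := by
    rintro ⟨i, l⟩ j
    rw [← blockConfig_entry_lt_query_iff g, ← blockConfig_entry_lt_query_iff g']
    have hclopen := isClopen_setOf_entry_lt_query (sizes := sizes) i l j
    exact ⟨fun hx => hclopen.connectedComponent_subset hx (ConnectedComponents.coe_eq_coe'.mp h.symm),
      fun hx => hclopen.connectedComponent_subset hx (ConnectedComponents.coe_eq_coe'.mp h)⟩
  funext a
  exact le_antisymm ((key a _).mpr le_rfl) ((key a _).mp le_rfl)

end

open Finset in
/-- With `s ∣ n` and `m = n / s` queries, the number of connected components of `W`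
is at least `n! / (n₁! ⋯ n_k! · (s!)^{n/s})` (as this bound is a real number, the
cardinality is at least its integer ceiling). -/
theorem stmt5 (k m n s : ℕ) (sizes : Fin k → ℕ)
    (hk : 1 ≤ k) (hsizes : ∀ i, 1 ≤ sizes i) (hn : n = ∑ i, sizes i)
    (hs : 1 ≤ s) (hsdvd : s ∣ n) (hm : m = n / s) (hm1 : 1 ≤ m) :
    (↑⌈(n.factorial : ℝ) /
        ((∏ i, ((sizes i).factorial : ℝ)) * (s.factorial : ℝ) ^ (n / s))⌉₊ : Cardinal) ≤
      Cardinal.mk (ConnectedComponents (W k m sizes)) := by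
  classical
  have hcard : Fintype.card (Σ i, Fin (sizes i)) = n := by simp [hn]
  have hms : n = m * s := by rw [hm, Nat.div_mul_cancel hsdvd]
  obtain ⟨e⟩ : Nonempty ((Σ i, Fin (sizes i)) ≃ Fin m × Fin s) :=
    Fintype.card_eq.mp (by rw [hcard, hms]; simp)
  have hfiber (j : Fin m) : Fintype.card {a // (e a).1 = j} = s := by
    rw [Fintype.card_congr (e.subtypeEquiv (q := fun x => x.1 = j) fun _ => Iff.rfl),
      Fintype.card_congr (Equiv.prodSubtypeFstEquivSubtypeProd (p := fun i => i = j))]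
    simp
  set S : Finset ((Σ i, Fin (sizes i)) → Fin m) :=
    (univ : Finset (Equiv.Perm (Σ i, Fin (sizes i)))).image fun σ : Equiv.Perm _ =>
      (fun a => (e a).1) ∘ σ
    with hSdef
  have hS := factorial_card_le_card_image_comp_perm fun a => (e a).1
  simp only [hfiber, prod_const, card_univ, Fintype.card_fin, hcard, ← hSdef] at hS
  have hT := card_le_prod_factorial_mul_card_filter_monotone sizes S fun f hf σ => by
    obtain ⟨τ, -, rfl⟩ := mem_image.mp hf
    exact mem_image.mpr ⟨σ.trans τ, mem_univ _, rfl⟩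
  set T := {f ∈ S | ∀ i, Monotone fun l => f ⟨i, l⟩} with hTdef
  have hTW (g : T) : blockConfig g.1 ∈ W k m sizes := by
    obtain ⟨hgS, hmono⟩ := mem_filter.mp g.2
    obtain ⟨τ, -, hτ⟩ := mem_image.mp hgS
    refine blockConfig_mem_W hmono fun j => ⟨τ.symm (e.symm (j, ⟨0, hs⟩)), ?_⟩
    simp [← hτ]
  have hle : (#T : Cardinal) ≤ Cardinal.mk (ConnectedComponents (W k m sizes)) := by
    rw [← Cardinal.mk_coe_finset]
    exact Cardinal.mk_le_of_injective
      (f := fun g : T => ((⟨_, hTW g⟩ : W k m sizes) : ConnectedComponents (W k m sizes)))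
      fun g g' h => Subtype.ext (eq_of_blockConfig_connected _ _ h)
  refine le_trans (Nat.cast_le.mpr (Nat.ceil_le.mpr ?_)) hle
  rw [← hm, div_le_iff₀ (by positivity)]
  have := hS.trans (Nat.mul_le_mul_left _ hT)
  calc (n.factorial : ℝ) ≤ _ := Nat.cast_le.mpr this
    _ = _ := by push_cast; ring
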